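/- arXiv:1409.5711 — 2 statements merged into one kernel-verified Lean document; each statement's English description precedes it below -/
import Mathlib

section
/- Let S and T be densely defined linear operators from a Hilbert space H to a Hilbert space K satisfying: (a) T is closable; (b) dom T ⊆ dom S and dom T* ⊆ dom S*; (c) ‖Sh‖² ≤ ‖Th‖² + ‖h‖² for all h ∈ dom T; (d) there exists 0 ≤ q < 1 such that ‖S*k‖² ≤ q‖T*k‖² + ‖k‖² for all k ∈ dom T*. Then T + S (with domain dom T) is closable and (T + S)* = T* + S*. -/
/- STATEMENT 11: Proposition 15 of the paper (extension of Hess–Kato). -/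

variable {𝕜 H K : Type*} [RCLike 𝕜]
  [NormedAddCommGroup H] [InnerProductSpace 𝕜 H] [CompleteSpace H]
  [NormedAddCommGroup K] [InnerProductSpace 𝕜 K] [CompleteSpace K]

/-- The sum of two partially defined operators, restricted to the domain of the first
one (which is assumed to be contained in the domain of the second one). -/
def LinearPMap.sumRestrict {R E F : Type*} [Ring R] [AddCommGroup E] [Module R E]
    [AddCommGroup F] [Module R F] (B S : E →ₗ.[R] F) (h : B.domain ≤ S.domain) :
    E →ₗ.[R] F where
  domain := B.domain
  toFun := B.toFun + S.toFun.comp (Submodule.inclusion h)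

open Filter Topology InnerProductSpace

/-- Orthogonal projection onto a closed subspace of a product of two Hilbert spaces. -/
theorem Submodule.exists_mem_forall_inner_prod_eq_zero (G : Submodule 𝕜 (H × K))
    (hG : IsClosed (G : Set (H × K))) (a : H) (b : K) :
    ∃ p ∈ G, ∀ g ∈ G, ⟪g.1, a - p.1⟫_𝕜 + ⟪g.2, b - p.2⟫_𝕜 = 0 := by
  let G' : Submodule 𝕜 (WithLp 2 (H × K)) :=
    G.comap (WithLp.linearEquiv 2 𝕜 (H × K)).toLinearMap
  have hG' : IsClosed (G' : Set (WithLp 2 (H × K))) :=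
    hG.preimage (WithLp.prod_continuous_ofLp 2 H K)
  have : CompleteSpace G' := hG'.completeSpace_coe
  obtain ⟨y, hy, z, hz, hyz⟩ := G'.exists_add_mem_mem_orthogonal (WithLp.toLp 2 (a, b))
  refine ⟨WithLp.ofLp y, hy, fun g hg => ?_⟩
  have hzy : z = WithLp.toLp 2 (a, b) - y := by rw [hyz, add_sub_cancel_left]
  have h0 := (G'.mem_orthogonal z).1 hz (WithLp.toLp 2 g) hg
  rw [hzy, WithLp.prod_inner_apply] at h0
  exact h0

/-- A linear map dominated by two others sends Cauchy sequences for both of them to a Cauchy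
sequence. -/
theorem LinearMap.cauchySeq_of_norm_le {V E F G : Type*} [AddCommGroup V] [Module 𝕜 V]
    [NormedAddCommGroup E] [Module 𝕜 E] [NormedAddCommGroup F] [Module 𝕜 F]
    [NormedAddCommGroup G] [Module 𝕜 G] (f : V →ₗ[𝕜] E) (g : V →ₗ[𝕜] F) (h : V →ₗ[𝕜] G)
    {C : ℝ} (hC : 0 ≤ C) (hf : ∀ x, ‖f x‖ ≤ C * (‖g x‖ + ‖h x‖)) {u : ℕ → V}
    (hg : CauchySeq fun n => g (u n)) (hh : CauchySeq fun n => h (u n)) :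
    CauchySeq fun n => f (u n) := by
  rw [Metric.cauchySeq_iff] at hg hh ⊢
  intro ε hε
  have hδ : 0 < ε / (2 * (C + 1)) := by positivity
  obtain ⟨N, hN⟩ := hg _ hδ
  obtain ⟨M, hM⟩ := hh _ hδ
  refine ⟨max N M, fun m hm n hn => ?_⟩
  have h1 := hN m (le_of_max_le_left hm) n (le_of_max_le_left hn)
  have h2 := hM m (le_of_max_le_right hm) n (le_of_max_le_right hn)
  have h3 := hf (u m - u n)
  rw [dist_eq_norm, ← map_sub] at h1 h2 ⊢
  calc ‖f (u m - u n)‖ ≤ C * (‖g (u m - u n)‖ + ‖h (u m - u n)‖) := h3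
    _ ≤ C * (ε / (2 * (C + 1)) + ε / (2 * (C + 1))) := by gcongr
    _ < ε := by
      have : C * (ε / (2 * (C + 1)) + ε / (2 * (C + 1))) = ε * (C / (C + 1)) := by
        field_simp
        ring
      rw [this]
      exact mul_lt_of_lt_one_right hε ((div_lt_one (by positivity)).2 (by linarith))

section

variable {E F : Type*} [NormedAddCommGroup E] [InnerProductSpace 𝕜 E]
  [NormedAddCommGroup F] [InnerProductSpace 𝕜 F]

/-- The equality case in the contraction argument of Wüst: the abstract vectors stand for
`t = T h`, `s = S h`, `a = T† k`, `b = S† k`. -/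
theorem eq_zero_and_eq_zero_of_inner_of_norm_le {h a b : E} {t s k : F}
    (htk : ⟪t, k⟫_𝕜 = ⟪h, a⟫_𝕜) (hsk : ⟪s, k⟫_𝕜 = ⟪h, b⟫_𝕜)
    (h₁ : ⟪t + s, t + k⟫_𝕜 = ⟪h, a - h⟫_𝕜)
    (h₂ : ⟪k, t + k⟫_𝕜 + ⟪a + b, a - h⟫_𝕜 = 0)
    (hs : ‖s‖ ^ 2 ≤ ‖t‖ ^ 2 + ‖h‖ ^ 2) (hb : ‖b‖ ^ 2 ≤ ‖a‖ ^ 2 + ‖k‖ ^ 2) :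
    h = 0 ∧ k = 0 := by
  have e₁ := congrArg RCLike.re htk
  have e₂ := congrArg RCLike.re hsk
  have e₃ := congrArg RCLike.re h₁
  have e₄ := congrArg RCLike.re h₂
  have n₁ := norm_add_sq (𝕜 := 𝕜) (t + k) s
  have n₂ := norm_add_sq (𝕜 := 𝕜) t k
  have n₃ := norm_sub_sq (𝕜 := 𝕜) (h - a) b
  have n₄ := norm_sub_sq (𝕜 := 𝕜) h a
  simp only [inner_add_left, inner_add_right, inner_sub_left, inner_sub_right, map_add, map_sub,
    map_zero, inner_self_eq_norm_sq] at e₃ e₄ n₁ n₃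
  have c₁ := inner_re_symm (𝕜 := 𝕜) k t
  have c₂ := inner_re_symm (𝕜 := 𝕜) s t
  have c₃ := inner_re_symm (𝕜 := 𝕜) s k
  have c₄ := inner_re_symm (𝕜 := 𝕜) a h
  have c₅ := inner_re_symm (𝕜 := 𝕜) b h
  have c₆ := inner_re_symm (𝕜 := 𝕜) b a
  have p₁ := sq_nonneg ‖t + k + s‖
  have p₂ := sq_nonneg ‖h - a - b‖
  have z₁ : h - a - b = 0 := by
    rw [← norm_eq_zero, ← sq_eq_zero_iff]
    linarith
  have z₂ : t + k + s = 0 := by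
    rw [← norm_eq_zero, ← sq_eq_zero_iff]
    linarith
  have w₁ : ‖h‖ ^ 2 = RCLike.re ⟪h, a⟫_𝕜 + RCLike.re ⟪h, b⟫_𝕜 := by
    rw [← map_add, ← inner_add_right, ← inner_self_eq_norm_sq (𝕜 := 𝕜)]
    rw [sub_sub, sub_eq_zero] at z₁
    rw [← z₁]
  have w₂ : RCLike.re ⟪t, k⟫_𝕜 + RCLike.re ⟪s, k⟫_𝕜 = -‖k‖ ^ 2 := by
    rw [← map_add, ← inner_add_left, ← inner_self_eq_norm_sq (𝕜 := 𝕜), ← map_neg,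
      ← inner_neg_left]
    congr 2
    rw [eq_neg_iff_add_eq_zero, ← z₂]
    abel
  have q₁ := sq_nonneg ‖h‖
  have q₂ := sq_nonneg ‖k‖
  constructor
  · rw [← norm_eq_zero, ← sq_eq_zero_iff]
    linarith
  · rw [← norm_eq_zero, ← sq_eq_zero_iff]
    linarith

namespace LinearPMap

/-- Sequential description of the closure of the graph. -/
theorem exists_seq_of_mem_graph_topologicalClosure {T : E →ₗ.[𝕜] F} {p : E × F}
    (hp : p ∈ T.graph.topologicalClosure) :
    ∃ u : ℕ → T.domain, Tendsto (fun n => (u n : E)) atTop (𝓝 p.1) ∧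
      Tendsto (fun n => T (u n)) atTop (𝓝 p.2) := by
  obtain ⟨x, hx, hxp⟩ := mem_closure_iff_seq_limit.1 hp
  choose u hu using fun n => (mem_graph_iff' T).1 (hx n)
  refine ⟨u, ?_, ?_⟩
  · exact ((continuous_fst.tendsto p).comp hxp).congr fun n => congrArg Prod.fst (hu n).symm
  · exact ((continuous_snd.tendsto p).comp hxp).congr fun n => congrArg Prod.snd (hu n).symm

theorem inner_eq_inner_adjoint_of_mem_graph_topologicalClosure [CompleteSpace E] {T : E →ₗ.[𝕜] F}
    (hT : Dense (T.domain : Set E)) {p : E × F} (hp : p ∈ T.graph.topologicalClosure)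
    (k : T.adjoint.domain) : ⟪p.2, (k : F)⟫_𝕜 = ⟪p.1, T.adjoint k⟫_𝕜 := by
  obtain ⟨u, hu, hTu⟩ := exists_seq_of_mem_graph_topologicalClosure hp
  refine tendsto_nhds_unique (hTu.inner tendsto_const_nhds) ?_
  simpa only [(adjoint_isFormalAdjoint hT).symm _ k] using hu.inner tendsto_const_nhds

/-- The graph of the closure and the rotated graph of the adjoint span the product space. -/
theorem exists_mem_graph_topologicalClosure_add_adjoint [CompleteSpace E] [CompleteSpace F]
    {T : E →ₗ.[𝕜] F}
    (hT : Dense (T.domain : Set E)) (a : E) (b : F) :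
    ∃ p ∈ T.graph.topologicalClosure, ∃ k : T.adjoint.domain,
      p.1 - T.adjoint k = a ∧ p.2 + k = b := by
  obtain ⟨p, hp, h⟩ := T.graph.topologicalClosure.exists_mem_forall_inner_prod_eq_zero
    T.graph.isClosed_topologicalClosure a b
  have key (x : T.domain) : ⟪p.1 - a, (x : E)⟫_𝕜 = ⟪b - p.2, T x⟫_𝕜 := by
    have h1 := h _ (T.graph.le_topologicalClosure (T.mem_graph x))
    rw [← inner_conj_symm, ← inner_conj_symm (b - p.2), ← neg_sub a, inner_neg_right,
      eq_neg_of_add_eq_zero_right h1]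
  refine ⟨p, hp, ⟨b - p.2, mem_adjoint_domain_of_exists _ ⟨_, key⟩⟩, ?_, by simp⟩
  rw [adjoint_apply_eq hT _ key, sub_sub_cancel]

theorem IsClosable.eq_zero_of_mem_graph_topologicalClosure {T : E →ₗ.[𝕜] F} (hT : T.IsClosable)
    {y : F} (hy : ((0 : E), y) ∈ T.graph.topologicalClosure) : y = 0 := by
  obtain ⟨f, hf⟩ := hT
  rw [hf] at hy
  exact f.graph_fst_eq_zero_snd hy rfl

/-- The adjoint of a closable operator is densely defined. -/
theorem IsClosable.dense_adjoint_domain [CompleteSpace E] [CompleteSpace F]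
    {T : E →ₗ.[𝕜] F} (hT : T.IsClosable)
    (hd : Dense (T.domain : Set E)) : Dense (T.adjoint.domain : Set F) := by
  rw [Submodule.dense_iff_topologicalClosure_eq_top, Submodule.topologicalClosure_eq_top_iff,
    Submodule.eq_bot_iff]
  intro y hy
  obtain ⟨p, hp, k, h1, h2⟩ := exists_mem_graph_topologicalClosure_add_adjoint hd 0 y
  have h3 := inner_eq_inner_adjoint_of_mem_graph_topologicalClosure hd hp k
  have h4 := (Submodule.mem_orthogonal' _ _).1 hy k k.2
  rw [← sub_eq_zero.1 h1] at h3
  rw [← h2, inner_add_left, h3] at h4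
  have h5 : ‖p.1‖ ^ 2 + ‖(k : F)‖ ^ 2 = 0 := by
    rw [← inner_self_eq_norm_sq (𝕜 := 𝕜), ← inner_self_eq_norm_sq (𝕜 := 𝕜),
      ← _root_.map_add, h4, _root_.map_zero]
  have hp0 : p.1 = 0 := by
    rw [← norm_eq_zero, ← sq_eq_zero_iff]
    linarith [sq_nonneg ‖p.1‖, sq_nonneg ‖(k : F)‖]
  have hk0 : (k : F) = 0 := by
    rw [← norm_eq_zero, ← sq_eq_zero_iff]
    linarith [sq_nonneg ‖p.1‖, sq_nonneg ‖(k : F)‖]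
  rw [← h2, hk0, add_zero]
  refine hT.eq_zero_of_mem_graph_topologicalClosure ?_
  rwa [← hp0]

/-- An operator with densely defined adjoint is closable. -/
theorem isClosable_of_dense_adjoint_domain [CompleteSpace E]
    {T : E →ₗ.[𝕜] F} (hd : Dense (T.domain : Set E))
    (hT : Dense (T.adjoint.domain : Set F)) : T.IsClosable := by
  refine ⟨T.graph.topologicalClosure.toLinearPMap, (Submodule.toLinearPMap_graph_eq _ ?_).symm⟩
  intro p hp hp0
  refine hT.eq_zero_of_inner_left 𝕜 fun k hk => ?_
  rw [inner_eq_inner_adjoint_of_mem_graph_topologicalClosure hd hp ⟨k, hk⟩, hp0, inner_zero_left]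

theorem sumRestrict_apply (B S : E →ₗ.[𝕜] F) (h : B.domain ≤ S.domain) (x : B.domain) :
    B.sumRestrict S h x = B x + S (Submodule.inclusion h x) := rfl

/-- The sum of two closed operators is closed if the second one is relatively bounded with
respect to the first one, with relative bound less than one. -/
theorem isClosed_sumRestrict [CompleteSpace F]
    {A B : E →ₗ.[𝕜] F} (hA : A.IsClosed) (hB : B.IsClosed)
    (h : A.domain ≤ B.domain) {q : ℝ} (hq₀ : 0 ≤ q) (hq₁ : q < 1)
    (hq : ∀ x : A.domain,
      ‖B (Submodule.inclusion h x)‖ ^ 2 ≤ q * ‖A x‖ ^ 2 + ‖(x : E)‖ ^ 2) :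
    (A.sumRestrict B h).IsClosed := by
  have hr₁ : √q < 1 := by rwa [Real.sqrt_lt' one_pos, one_pow]
  have hC : 0 < 1 - √q := sub_pos.2 hr₁
  have hle (x : A.domain) :
      ‖A.toFun x‖ ≤ (1 - √q)⁻¹ * (‖(A.sumRestrict B h).toFun x‖ + ‖A.domain.subtype x‖) := by
    have h1 : ‖B (Submodule.inclusion h x)‖ ≤ √q * ‖A x‖ + ‖(x : E)‖ := by
      refine abs_le_of_sq_le_sq' ?_ (by positivity) |>.2
      have := mul_nonneg (mul_nonneg (Real.sqrt_nonneg q) (norm_nonneg (A x))) (norm_nonneg (x : E))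
      nlinarith [hq x, Real.sq_sqrt hq₀]
    have h2 : ‖A x‖ ≤ ‖A.sumRestrict B h x‖ + ‖B (Submodule.inclusion h x)‖ := by
      simpa only [sumRestrict_apply, add_sub_cancel_right] using
        norm_sub_le (A.sumRestrict B h x) (B (Submodule.inclusion h x))
    rw [le_inv_mul_iff₀ hC]
    change (1 - √q) * ‖A x‖ ≤ ‖A.sumRestrict B h x‖ + ‖(x : E)‖
    linarith
  refine isClosed_of_closure_subset fun p hp => ?_
  obtain ⟨u, hu, hsu⟩ := exists_seq_of_mem_graph_topologicalClosure (T := A.sumRestrict B h) hp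
  obtain ⟨w, hw⟩ := cauchySeq_tendsto_of_complete <|
    LinearMap.cauchySeq_of_norm_le A.toFun (A.sumRestrict B h).toFun A.domain.subtype
      (inv_nonneg.2 hC.le) hle (u := u) hsu.cauchySeq hu.cauchySeq
  have hBu : Tendsto (fun n => B (Submodule.inclusion h (u n))) atTop (𝓝 (p.2 - w)) :=
    (hsu.sub hw).congr fun n => add_sub_cancel_left (A (u n)) _
  have hpA : (p.1, w) ∈ A.graph := hA.mem_of_tendsto (hu.prodMk_nhds hw)
    (Eventually.of_forall fun n => A.mem_graph (u n))
  have hpB : (p.1, p.2 - w) ∈ B.graph := hB.mem_of_tendsto (hu.prodMk_nhds hBu)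
    (Eventually.of_forall fun n => B.mem_graph (Submodule.inclusion h (u n)))
  obtain ⟨x, hx, hAx⟩ := (mem_graph_iff A).1 hpA
  refine (mem_graph_iff _).2 ⟨x, hx, ?_⟩
  have hBx : B (Submodule.inclusion h x) = p.2 - w :=
    B.mem_graph_snd_inj (B.mem_graph _) hpB hx
  rw [sumRestrict_apply, hAx, hBx]
  exact add_sub_cancel _ _

/-- The sum of the adjoints is contained in the adjoint of the sum. -/
theorem adjoint_sumRestrict_le [CompleteSpace E] {S T : E →ₗ.[𝕜] F} (hdS : Dense (S.domain : Set E))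
    (hdT : Dense (T.domain : Set E)) (h₁ : T.domain ≤ S.domain)
    (h₂ : T.adjoint.domain ≤ S.adjoint.domain) :
    T.adjoint.sumRestrict S.adjoint h₂ ≤ (T.sumRestrict S h₁).adjoint := by
  refine IsFormalAdjoint.le_adjoint hdT fun x y => ?_
  refine (inner_add_left _ _ _).trans (Eq.trans ?_ (inner_add_right _ _ _).symm)
  exact congrArg₂ (· + ·) ((adjoint_isFormalAdjoint hdT).symm x y)
    ((adjoint_isFormalAdjoint hdS).symm (Submodule.inclusion h₁ x) (Submodule.inclusion h₂ y))

/-- Under the relative bounds with constant one, the graph of the sum of the adjoints is dense in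
the graph of the adjoint of the sum. -/
theorem eq_zero_of_mem_graph_adjoint_sumRestrict [CompleteSpace E] [CompleteSpace F]
    {S T : E →ₗ.[𝕜] F}
    (hdS : Dense (S.domain : Set E)) (hdT : Dense (T.domain : Set E)) (hT : T.IsClosable)
    (h₁ : T.domain ≤ S.domain) (h₂ : T.adjoint.domain ≤ S.adjoint.domain)
    (hS : ∀ x : T.domain, ‖S (Submodule.inclusion h₁ x)‖ ^ 2 ≤ ‖T x‖ ^ 2 + ‖(x : E)‖ ^ 2)
    (hS' : ∀ k : T.adjoint.domain,
      ‖S.adjoint (Submodule.inclusion h₂ k)‖ ^ 2 ≤ ‖T.adjoint k‖ ^ 2 + ‖(k : F)‖ ^ 2)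
    {v : F × E} (hv : v ∈ (T.sumRestrict S h₁).adjoint.graph)
    (horth : ∀ k : T.adjoint.domain,
      ⟪(k : F), v.1⟫_𝕜 + ⟪T.adjoint.sumRestrict S.adjoint h₂ k, v.2⟫_𝕜 = 0) :
    v = 0 := by
  obtain ⟨p, hp, k, hpk₁, hpk₂⟩ :=
    exists_mem_graph_topologicalClosure_add_adjoint hdT (-v.2) v.1
  obtain ⟨u, hu, hTu⟩ := exists_seq_of_mem_graph_topologicalClosure hp
  obtain ⟨s, hs⟩ := cauchySeq_tendsto_of_complete <|
    LinearMap.cauchySeq_of_norm_le (S.toFun.comp (Submodule.inclusion h₁)) T.toFun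
      T.domain.subtype zero_le_one (fun x => by
        rw [one_mul]
        refine (abs_le_of_sq_le_sq' ((hS x).trans ?_) (by positivity)).2
        change ‖T x‖ ^ 2 + ‖(x : E)‖ ^ 2 ≤ (‖T x‖ + ‖(x : E)‖) ^ 2
        nlinarith [mul_nonneg (norm_nonneg (T x)) (norm_nonneg (x : E))])
      (u := u) hTu.cauchySeq hu.cauchySeq
  change Tendsto (fun n => S (Submodule.inclusion h₁ (u n))) atTop (𝓝 s) at hs
  have htk := inner_eq_inner_adjoint_of_mem_graph_topologicalClosure hdT hp k
  have hsk : ⟪s, (k : F)⟫_𝕜 = ⟪p.1, S.adjoint (Submodule.inclusion h₂ k)⟫_𝕜 :=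
    tendsto_nhds_unique (hs.inner tendsto_const_nhds) <|
      (hu.inner tendsto_const_nhds).congr fun n => ((adjoint_isFormalAdjoint hdS).symm
        (Submodule.inclusion h₁ (u n)) (Submodule.inclusion h₂ k)).symm
  have hsum : ⟪p.2 + s, v.1⟫_𝕜 = ⟪p.1, v.2⟫_𝕜 := by
    obtain ⟨y, hy₁, hy₂⟩ := (mem_graph_iff _).1 hv
    rw [← hy₁, ← hy₂]
    exact tendsto_nhds_unique ((hTu.add hs).inner tendsto_const_nhds) <|
      (hu.inner tendsto_const_nhds).congr fun n =>
        ((adjoint_isFormalAdjoint (T := T.sumRestrict S h₁) hdT).symm (u n) y).symm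
  have hns : ‖s‖ ^ 2 ≤ ‖p.2‖ ^ 2 + ‖p.1‖ ^ 2 :=
    le_of_tendsto_of_tendsto' (hs.norm.pow 2) ((hTu.norm.pow 2).add (hu.norm.pow 2))
      fun n => hS (u n)
  have hv₂ : v.2 = T.adjoint k - p.1 := by rw [← neg_sub, hpk₁, neg_neg]
  have hk := horth k
  rw [hv₂, ← hpk₂] at hk hsum
  obtain ⟨hp0, hk0⟩ := eq_zero_and_eq_zero_of_inner_of_norm_le htk hsk hsum hk hns (hS' k)
  have hp0' : p.2 = 0 := hT.eq_zero_of_mem_graph_topologicalClosure (by rwa [← hp0])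
  refine Prod.ext ?_ ?_
  · rw [← hpk₂, hp0', hk0, add_zero, Prod.fst_zero]
  · rw [hv₂, hp0, Submodule.coe_eq_zero.1 hk0, map_zero, sub_zero, Prod.snd_zero]

end LinearPMap

end

theorem sum_closable_stmt11
    (S T : H →ₗ.[𝕜] K)
    (hdS : Dense (S.domain : Set H)) (hdT : Dense (T.domain : Set H))
    (ha : T.IsClosable)
    (hb₁ : T.domain ≤ S.domain) (hb₂ : T.adjoint.domain ≤ S.adjoint.domain)
    (hc : ∀ h : T.domain,
      ‖S (Submodule.inclusion hb₁ h)‖ ^ 2 ≤ ‖T h‖ ^ 2 + ‖(h : H)‖ ^ 2)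
    (hd : ∃ q : ℝ, 0 ≤ q ∧ q < 1 ∧ ∀ k : T.adjoint.domain,
      ‖S.adjoint (Submodule.inclusion hb₂ k)‖ ^ 2 ≤
        q * ‖T.adjoint k‖ ^ 2 + ‖(k : K)‖ ^ 2) :
    (T.sumRestrict S hb₁).IsClosable ∧
      (T.sumRestrict S hb₁).adjoint = T.adjoint.sumRestrict S.adjoint hb₂ := by
  obtain ⟨q, hq₀, hq₁, hq⟩ := hd
  have hle := LinearPMap.adjoint_sumRestrict_le hdS hdT hb₁ hb₂
  have hdsum : Dense ((T.sumRestrict S hb₁).domain : Set H) := hdT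
  refine ⟨LinearPMap.isClosable_of_dense_adjoint_domain hdsum
    ((ha.dense_adjoint_domain hdT).mono hle.1), le_antisymm ?_ hle⟩
  refine LinearPMap.le_of_le_graph fun p hp => ?_
  have hcl : (T.adjoint.sumRestrict S.adjoint hb₂).IsClosed :=
    LinearPMap.isClosed_sumRestrict (LinearPMap.adjoint_isClosed hdT)
      (LinearPMap.adjoint_isClosed hdS) hb₂ hq₀ hq₁ hq
  obtain ⟨g, hg, horth⟩ := Submodule.exists_mem_forall_inner_prod_eq_zero _ hcl p.1 p.2
  suffices p - g = 0 by rwa [sub_eq_zero.1 this]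
  have hv : p - g ∈ (T.sumRestrict S hb₁).adjoint.graph :=
    sub_mem hp (LinearPMap.le_graph_of_le hle hg)
  simp only [← Prod.fst_sub, ← Prod.snd_sub] at horth
  exact LinearPMap.eq_zero_of_mem_graph_adjoint_sumRestrict hdS hdT ha hb₁ hb₂ hc
    (fun k => (hq k).trans <| by
      gcongr
      exact mul_le_of_le_one_left (sq_nonneg _) hq₁.le) hv
    fun k => horth _ (LinearPMap.mem_graph (T.adjoint.sumRestrict S.adjoint hb₂) k)
end

section
/- Let S and T be linear operators acting in a Hilbert space H such that: (a) S is essentially selfadjoint and dom S ⊆ dom T; (b) ‖Th‖² ≤ ‖Sh‖² + ‖h‖² for all h ∈ dom S; (c) ⟨Th, k⟩ = ⟨h, Tk⟩ for all h, k ∈ dom S (i.e. the restriction of T to dom S is symmetric). Then S + T (with domain dom S) is essentially selfadjoint. -/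
/- STATEMENT 12: Corollary 18 of the paper (generalized Wüst theorem). -/

variable {𝕜 H : Type*} [RCLike 𝕜]
  [NormedAddCommGroup H] [InnerProductSpace 𝕜 H] [CompleteSpace H]

local notation "⟪" x ", " y "⟫" => @inner 𝕜 _ _ x y

/-- A densely defined operator is essentially selfadjoint if it is closable and its
closure is selfadjoint. -/
def LinearPMap.IsEssentiallySelfAdjoint (S : H →ₗ.[𝕜] H) : Prop :=
  Dense (S.domain : Set H) ∧ S.IsClosable ∧ IsSelfAdjoint S.closure

section DenseRange

variable {V E : Type*} [AddCommGroup V] [Module 𝕜 V]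
  [NormedAddCommGroup E] [InnerProductSpace 𝕜 E]

/-- A linear map has dense range as soon as only the zero vector is orthogonal to its range. -/
theorem LinearMap.denseRange_of_inner_eq_zero [CompleteSpace E] (K : V →ₗ[𝕜] E)
    (h : ∀ v : E, (∀ p, inner 𝕜 v (K p) = 0) → v = 0) : DenseRange K := by
  have h_top : (LinearMap.range K).topologicalClosure = ⊤ := by
    rw [Submodule.topologicalClosure_eq_top_iff, Submodule.eq_bot_iff]
    intro v hv
    exact h v fun p ↦ (Submodule.mem_orthogonal' _ _).1 hv _ ⟨p, rfl⟩
  have := (Submodule.dense_iff_topologicalClosure_eq_top).2 h_top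
  rwa [LinearMap.coe_range] at this

/-- Density of the range is stable under strictly relatively bounded perturbations. -/
theorem LinearMap.denseRange_add_of_norm_le_mul [CompleteSpace E] {K N : V →ₗ[𝕜] E}
    (hK : DenseRange K) {t : ℝ} (ht : t < 1) (hN : ∀ p, ‖N p‖ ≤ t * ‖K p‖) :
    DenseRange (K + N) := by
  refine LinearMap.denseRange_of_inner_eq_zero _ fun v hv ↦ ?_
  have h_bound : ∀ w : E, ‖inner 𝕜 v w‖ ≤ ‖v‖ * (t * ‖w‖) := by
    refine fun w ↦ hK.induction_on w (isClosed_le (by fun_prop) (by fun_prop)) fun p ↦ ?_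
    have h_eq : inner 𝕜 v (K p) = -inner 𝕜 v (N p) := by
      have := hv p
      rw [LinearMap.add_apply, inner_add_right] at this
      exact eq_neg_of_add_eq_zero_left this
    rw [h_eq, norm_neg]
    exact (norm_inner_le_norm _ _).trans (by gcongr; exact hN p)
  have hvv := h_bound v
  rw [inner_self_eq_norm_sq_to_K, norm_pow, RCLike.norm_ofReal, abs_norm] at hvv
  by_contra hne
  have := norm_pos_iff.2 hne
  nlinarith [mul_pos this this]

/-- Density of the range survives at the endpoint of the perturbation bound, provided the
perturbed maps are uniformly bounded below and the perturbation is symmetric. -/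
theorem LinearMap.denseRange_add_of_norm_le [CompleteSpace E] {J K N : V →ₗ[𝕜] E}
    (hJ : DenseRange J) (hK : DenseRange K) (hN : ∀ p, ‖N p‖ ≤ ‖K p‖)
    (hJK : ∀ (t : ℝ) (p : V), ‖J p‖ ≤ ‖(K + (t : 𝕜) • N) p‖)
    (hNJ : ∀ p q, inner 𝕜 (N p) (J q) = inner 𝕜 (J p) (N q)) :
    DenseRange (K + N) := by
  refine LinearMap.denseRange_of_inner_eq_zero _ fun v hv ↦ ?_
  by_contra hne
  have hpos : 0 < ‖v‖ := norm_pos_iff.2 hne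
  obtain ⟨q, hq⟩ := hJ.exists_dist_lt v (show 0 < ‖v‖ / 4 by positivity)
  rw [dist_eq_norm] at hq
  obtain ⟨δ, hδ, hδ1, hδq⟩ : ∃ δ : ℝ, 0 < δ ∧ δ ≤ 1 ∧ δ * ‖N q‖ ≤ ‖v‖ / 4 := by
    refine ⟨min 1 (‖v‖ / 4 / (‖N q‖ + 1)), by positivity, min_le_left _ _, ?_⟩
    calc min 1 (‖v‖ / 4 / (‖N q‖ + 1)) * ‖N q‖
        ≤ ‖v‖ / 4 / (‖N q‖ + 1) * (‖N q‖ + 1) := by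
          gcongr
          · exact min_le_right _ _
          · linarith
      _ = ‖v‖ / 4 := by field_simp
  have h_dense : DenseRange (K + ((1 - δ : ℝ) : 𝕜) • N) := by
    refine LinearMap.denseRange_add_of_norm_le_mul hK (t := 1 - δ) (by linarith) fun p ↦ ?_
    rw [LinearMap.smul_apply, norm_smul, RCLike.norm_ofReal, abs_of_nonneg (by linarith)]
    exact mul_le_mul_of_nonneg_left (hN p) (by linarith)
  obtain ⟨p, hp⟩ := h_dense.exists_dist_lt v (show 0 < ‖v‖ / 4 by positivity)
  rw [dist_eq_norm] at hp
  set w := (K + ((1 - δ : ℝ) : 𝕜) • N) p with hw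
  have hw_norm : ‖w‖ ≤ 5 / 4 * ‖v‖ := by
    have := norm_sub_norm_le w v
    rw [norm_sub_rev] at this
    linarith
  have hw_sub : (K + N) p - w = (δ : 𝕜) • N p := by
    rw [hw]
    simp only [LinearMap.add_apply, LinearMap.smul_apply]
    push_cast
    module
  have hNp : δ * ‖N p‖ ≤ ‖w‖ := by
    have hK_eq : K p = w - ((1 - δ : ℝ) : 𝕜) • N p := by
      rw [hw]
      simp
    have hK_le : ‖K p‖ ≤ ‖w‖ + (1 - δ) * ‖N p‖ := by
      rw [hK_eq]
      refine (norm_sub_le _ _).trans ?_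
      rw [norm_smul, RCLike.norm_ofReal, abs_of_nonneg (by linarith)]
    linarith [hN p]
  have hv_w : inner 𝕜 v w = -inner 𝕜 v ((δ : 𝕜) • N p) := by
    rw [← hw_sub, inner_sub_right, hv p, zero_sub, neg_neg]
  have h_upper : ‖inner 𝕜 v w‖ ≤ 1 / 2 * ‖v‖ * ‖w‖ := by
    have h_split : inner 𝕜 v ((δ : 𝕜) • N p) =
        inner 𝕜 (v - J q) ((δ : 𝕜) • N p) + (δ : 𝕜) * inner 𝕜 (N q) (J p) := by
      rw [hNJ, inner_sub_left, inner_smul_right _ (N p), inner_smul_right _ (N p)]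
      ring
    have h_smul : ‖(δ : 𝕜) • N p‖ ≤ ‖w‖ := by
      rwa [norm_smul, RCLike.norm_ofReal, abs_of_pos hδ]
    rw [hv_w, norm_neg, h_split]
    calc _ ≤ ‖v - J q‖ * ‖(δ : 𝕜) • N p‖ + δ * (‖N q‖ * ‖J p‖) := by
          refine (norm_add_le _ _).trans (add_le_add (norm_inner_le_norm _ _) ?_)
          rw [norm_mul, RCLike.norm_ofReal, abs_of_pos hδ]
          gcongr
          exact norm_inner_le_norm _ _
      _ ≤ ‖v‖ / 4 * ‖w‖ + ‖v‖ / 4 * ‖w‖ := by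
          rw [← mul_assoc δ]
          gcongr
          exact hJK _ p
      _ = _ := by ring
  have h_lower : ‖v‖ ^ 2 ≤ ‖inner 𝕜 v w‖ + ‖v‖ * ‖v - w‖ := by
    have h_sq : ‖v‖ ^ 2 = ‖inner 𝕜 v v‖ := by
      rw [inner_self_eq_norm_sq_to_K, norm_pow, RCLike.norm_ofReal, abs_norm]
    have h_split : inner 𝕜 v v = inner 𝕜 v w + inner 𝕜 v (v - w) := by
      rw [inner_sub_right]
      ring
    rw [h_sq, h_split]
    exact (norm_add_le _ _).trans (by gcongr; exact norm_inner_le_norm _ _)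
  nlinarith [mul_pos hpos hpos]

end DenseRange

section DeficiencyMap

variable {F : Type*} [NormedAddCommGroup F] [InnerProductSpace 𝕜 F]

/-- The map `(x, y) ↦ (x + A y, A x - y)` on `D × D`, a version of `A + i` that makes sense over
the reals. -/
def LinearMap.deficiencyMap {D : Submodule 𝕜 F} (A : D →ₗ[𝕜] F) :
    (D × D) →ₗ[𝕜] WithLp 2 (F × F) :=
  (WithLp.linearEquiv 2 𝕜 (F × F)).symm.toLinearMap ∘ₗ
    ((D.subtype ∘ₗ LinearMap.fst 𝕜 D D + A ∘ₗ LinearMap.snd 𝕜 D D).prod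
      (A ∘ₗ LinearMap.fst 𝕜 D D - D.subtype ∘ₗ LinearMap.snd 𝕜 D D))

/-- The map `(x, y) ↦ (A y, A x)` on `D × D`. -/
def LinearMap.swapMap {D : Submodule 𝕜 F} (A : D →ₗ[𝕜] F) :
    (D × D) →ₗ[𝕜] WithLp 2 (F × F) :=
  (WithLp.linearEquiv 2 𝕜 (F × F)).symm.toLinearMap ∘ₗ
    ((A ∘ₗ LinearMap.snd 𝕜 D D).prod (A ∘ₗ LinearMap.fst 𝕜 D D))

/-- The inclusion of `D × D`. -/
def Submodule.prodSubtypeL2 (D : Submodule 𝕜 F) : (D × D) →ₗ[𝕜] WithLp 2 (F × F) :=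
  (WithLp.linearEquiv 2 𝕜 (F × F)).symm.toLinearMap ∘ₗ D.subtype.prodMap D.subtype

variable {D : Submodule 𝕜 F}

theorem LinearMap.deficiencyMap_apply (A : D →ₗ[𝕜] F) (p : D × D) :
    A.deficiencyMap p = WithLp.toLp 2 ((p.1 : F) + A p.2, A p.1 - p.2) := rfl

theorem LinearMap.swapMap_apply (A : D →ₗ[𝕜] F) (p : D × D) :
    A.swapMap p = WithLp.toLp 2 (A p.2, A p.1) := rfl

theorem Submodule.prodSubtypeL2_apply (p : D × D) :
    D.prodSubtypeL2 p = WithLp.toLp 2 ((p.1 : F), (p.2 : F)) := rfl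

theorem LinearMap.deficiencyMap_add (A B : D →ₗ[𝕜] F) :
    (A + B).deficiencyMap = A.deficiencyMap + B.swapMap := by
  refine LinearMap.ext fun p ↦ (WithLp.ofLp_injective 2) (Prod.ext ?_ ?_)
  · simp [deficiencyMap_apply, swapMap_apply, add_assoc]
  · simp [deficiencyMap_apply, swapMap_apply, add_sub_right_comm]

theorem LinearMap.swapMap_smul (c : 𝕜) (A : D →ₗ[𝕜] F) : (c • A).swapMap = c • A.swapMap :=
  rfl

theorem LinearMap.norm_sq_deficiencyMap {A : D →ₗ[𝕜] F}
    (hA : ∀ x y : D, ⟪A x, (y : F)⟫ = ⟪(x : F), A y⟫) (p : D × D) :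
    ‖A.deficiencyMap p‖ ^ 2 =
      ‖(p.1 : F)‖ ^ 2 + ‖(p.2 : F)‖ ^ 2 + ‖A p.1‖ ^ 2 + ‖A p.2‖ ^ 2 := by
  rw [WithLp.prod_norm_sq_eq_of_L2, deficiencyMap_apply]
  change ‖(p.1 : F) + A p.2‖ ^ 2 + ‖A p.1 - p.2‖ ^ 2 = _
  rw [norm_add_sq (𝕜 := 𝕜), norm_sub_sq (𝕜 := 𝕜), hA p.1 p.2]
  ring

theorem Submodule.norm_sq_prodSubtypeL2 (p : D × D) :
    ‖D.prodSubtypeL2 p‖ ^ 2 = ‖(p.1 : F)‖ ^ 2 + ‖(p.2 : F)‖ ^ 2 :=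
  WithLp.prod_norm_sq_eq_of_L2 _

theorem LinearMap.norm_sq_swapMap (A : D →ₗ[𝕜] F) (p : D × D) :
    ‖A.swapMap p‖ ^ 2 = ‖A p.2‖ ^ 2 + ‖A p.1‖ ^ 2 :=
  WithLp.prod_norm_sq_eq_of_L2 _

theorem Submodule.denseRange_prodSubtypeL2 (hD : Dense (D : Set F)) :
    DenseRange D.prodSubtypeL2 := by
  have h_range : DenseRange (Prod.map ((↑) : D → F) ((↑) : D → F)) :=
    hD.denseRange_val.prodMap hD.denseRange_val
  exact (WithLp.toLp_surjective 2).denseRange.comp h_range (WithLp.prod_continuous_toLp 2 F F)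

/-- Wüst's perturbation theorem for the density of the range of `A + i`. -/
theorem LinearMap.denseRange_deficiencyMap_add [CompleteSpace F]
    (hD : Dense (D : Set F)) {A B : D →ₗ[𝕜] F}
    (hA : ∀ x y : D, ⟪A x, (y : F)⟫ = ⟪(x : F), A y⟫)
    (hB : ∀ x y : D, ⟪B x, (y : F)⟫ = ⟪(x : F), B y⟫)
    (hBA : ∀ x : D, ‖B x‖ ^ 2 ≤ ‖A x‖ ^ 2 + ‖(x : F)‖ ^ 2)
    (h : DenseRange A.deficiencyMap) : DenseRange (A + B).deficiencyMap := by
  rw [deficiencyMap_add]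
  refine LinearMap.denseRange_add_of_norm_le (Submodule.denseRange_prodSubtypeL2 hD) h ?_ ?_ ?_
  · intro p
    refine le_of_sq_le_sq ?_ (norm_nonneg _)
    rw [norm_sq_swapMap, norm_sq_deficiencyMap hA]
    linarith [hBA p.1, hBA p.2]
  · intro t p
    refine le_of_sq_le_sq ?_ (norm_nonneg _)
    rw [← swapMap_smul, ← deficiencyMap_add, norm_sq_deficiencyMap, Submodule.norm_sq_prodSubtypeL2]
    · have := sq_nonneg ‖(A + (t : 𝕜) • B) p.1‖
      have := sq_nonneg ‖(A + (t : 𝕜) • B) p.2‖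
      linarith
    · intro x y
      simp [inner_add_left, inner_add_right, inner_smul_left, inner_smul_right, hA, hB]
  · intro p q
    simp only [swapMap_apply, Submodule.prodSubtypeL2_apply, WithLp.prod_inner_apply, hB]
    exact add_comm _ _

end DeficiencyMap

section AdjointGraph

variable {F : Type*} [NormedAddCommGroup F] [InnerProductSpace 𝕜 F]

theorem Submodule.le_adjoint_adjoint (g : Submodule 𝕜 (F × F)) : g ≤ g.adjoint.adjoint := by
  rintro ⟨a, b⟩ hab
  rw [Submodule.mem_adjoint_iff]
  intro c d hcd
  rw [Submodule.mem_adjoint_iff] at hcd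
  have := congrArg (starRingEnd 𝕜) (hcd a b hab)
  simp only [map_sub, inner_conj_symm, map_zero] at this
  rw [← neg_sub, this, neg_zero]

theorem Submodule.adjoint_anti {g g' : Submodule 𝕜 (F × F)} (h : g ≤ g') :
    g'.adjoint ≤ g.adjoint := by
  intro x hx
  rw [Submodule.mem_adjoint_iff] at hx ⊢
  exact fun a b hab ↦ hx a b (h hab)

theorem Submodule.isClosed_adjoint (g : Submodule 𝕜 (F × F)) :
    IsClosed (g.adjoint : Set (F × F)) := by
  have h_eq : (g.adjoint : Set (F × F)) =
      ⋂ p : g, {x : F × F | ⟪(p : F × F).2, x.1⟫ - ⟪(p : F × F).1, x.2⟫ = 0} := by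
    ext x
    simp [Submodule.mem_adjoint_iff]
  rw [h_eq]
  exact isClosed_iInter fun p ↦ isClosed_eq (by fun_prop) (by fun_prop)

theorem Submodule.adjoint_topologicalClosure (g : Submodule 𝕜 (F × F)) :
    g.topologicalClosure.adjoint = g.adjoint :=
  le_antisymm (Submodule.adjoint_anti g.le_topologicalClosure) <|
    g.adjoint.le_adjoint_adjoint.trans <| Submodule.adjoint_anti <|
      g.topologicalClosure_minimal g.le_adjoint_adjoint (Submodule.isClosed_adjoint _)

theorem LinearPMap.topologicalClosure_graph_eq_adjoint {A : F →ₗ.[𝕜] F}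
    (h_symm : A.graph ≤ A.graph.adjoint) (hA : DenseRange A.toFun.deficiencyMap) :
    A.graph.topologicalClosure = A.graph.adjoint := by
  refine le_antisymm
    (A.graph.topologicalClosure_minimal h_symm (Submodule.isClosed_adjoint _)) fun v hv ↦ ?_
  have h_closure : WithLp.toLp 2 v ∈ _root_.closure (WithLp.toLp 2 '' (A.graph : Set (F × F))) := by
    refine Metric.mem_closure_iff.2 fun ε hε ↦ ?_
    obtain ⟨⟨x, y⟩, hxy⟩ := hA.exists_dist_lt (WithLp.toLp 2 v) hε
    have hx : ((x : F), A x) ∈ A.graph := A.mem_graph x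
    refine ⟨WithLp.toLp 2 ((x : F), A x), ⟨_, hx, rfl⟩, lt_of_le_of_lt ?_ hxy⟩
    rw [dist_eq_norm, dist_eq_norm]
    have h_split : WithLp.toLp 2 v - A.toFun.deficiencyMap (x, y) =
        (WithLp.toLp 2 v - WithLp.toLp 2 ((x : F), A x)) - WithLp.toLp 2 (A y, -(y : F)) := by
      refine (WithLp.ofLp_injective 2) (Prod.ext ?_ ?_)
      · simp [LinearMap.deficiencyMap_apply, sub_sub]
      · simp only [LinearMap.deficiencyMap_apply, WithLp.ofLp_sub, Prod.snd_sub]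
        change v.2 - (A x - y) = v.2 - A x - -y
        abel
    have h_orth : ⟪WithLp.toLp 2 (A y, -(y : F)),
        WithLp.toLp 2 v - WithLp.toLp 2 ((x : F), A x)⟫ = 0 := by
      have := (Submodule.mem_adjoint_iff _ _).1 (sub_mem hv (h_symm hx)) _ _ (A.mem_graph y)
      rw [sub_eq_add_neg, ← inner_neg_left] at this
      exact this
    rw [h_split]
    refine le_of_sq_le_sq ?_ (norm_nonneg _)
    rw [norm_sub_sq (𝕜 := 𝕜) (WithLp.toLp 2 v - _), inner_eq_zero_symm.1 h_orth,
      _root_.map_zero]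
    linarith [sq_nonneg ‖WithLp.toLp 2 (A y, -(y : F))‖]
  have h_image := image_closure_subset_closure_image (WithLp.prod_continuous_ofLp 2 F F)
    (Set.mem_image_of_mem _ h_closure)
  rw [Set.image_image] at h_image
  simpa [← SetLike.mem_coe] using h_image

end AdjointGraph

/-- A densely defined operator is essentially selfadjoint iff the closure of its graph is the
adjoint of its graph. -/
theorem LinearPMap.isEssentiallySelfAdjoint_iff {A : H →ₗ.[𝕜] H}
    (hA : Dense (A.domain : Set H)) :
    A.IsEssentiallySelfAdjoint ↔ A.graph.topologicalClosure = A.graph.adjoint := by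
  have hA' : Dense (A.closure.domain : Set H) := hA.mono A.le_closure.1
  constructor
  · rintro ⟨-, h_closable, h_sa⟩
    have h_graph := congrArg LinearPMap.graph (LinearPMap.isSelfAdjoint_def.1 h_sa)
    rwa [LinearPMap.adjoint_graph_eq_graph_adjoint hA', ← h_closable.graph_closure_eq_closure_graph,
      Submodule.adjoint_topologicalClosure, eq_comm] at h_graph
  · intro h
    have h_closable : A.IsClosable :=
      ⟨A.adjoint, by rw [h, LinearPMap.adjoint_graph_eq_graph_adjoint hA]⟩
    refine ⟨hA, h_closable, LinearPMap.isSelfAdjoint_def.2 (LinearPMap.eq_of_eq_graph ?_)⟩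
    rw [LinearPMap.adjoint_graph_eq_graph_adjoint hA', ← h_closable.graph_closure_eq_closure_graph,
      Submodule.adjoint_topologicalClosure, h]

theorem LinearPMap.denseRange_deficiencyMap {A : H →ₗ.[𝕜] H}
    (hA : A.graph.topologicalClosure = A.graph.adjoint) :
    DenseRange A.toFun.deficiencyMap := by
  refine LinearMap.denseRange_of_inner_eq_zero _ fun v hv ↦ ?_
  have hv' : ∀ x y : A.domain, ⟪(x : H) + A y, v.fst⟫ + ⟪A x - y, v.snd⟫ = 0 := fun x y ↦
    inner_eq_zero_symm.1 (hv (x, y))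
  have h_mem₁ : (v.snd, -v.fst) ∈ A.graph.adjoint := by
    rw [Submodule.mem_adjoint_iff]
    intro a b hab
    obtain ⟨x, rfl, rfl⟩ := LinearPMap.mem_graph_iff _ |>.1 hab
    simpa [add_comm] using hv' x 0
  have h_mem₂ : (v.fst, v.snd) ∈ A.graph.adjoint := by
    rw [Submodule.mem_adjoint_iff]
    intro a b hab
    obtain ⟨x, rfl, rfl⟩ := LinearPMap.mem_graph_iff _ |>.1 hab
    simpa [sub_eq_add_neg] using hv' 0 x
  rw [← hA] at h_mem₁
  rw [← Submodule.adjoint_topologicalClosure, Submodule.mem_adjoint_iff] at h_mem₂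
  have h_zero : ⟪v, v⟫ = 0 := by
    have := h_mem₂ _ _ h_mem₁
    rw [inner_neg_left, ← neg_add', neg_eq_zero] at this
    exact this
  exact inner_self_eq_zero.1 h_zero

theorem sum_closable_stmt12
    (S T : H →ₗ.[𝕜] H)
    (ha₁ : S.IsEssentiallySelfAdjoint) (ha₂ : S.domain ≤ T.domain)
    (hb : ∀ h : S.domain,
      ‖T (Submodule.inclusion ha₂ h)‖ ^ 2 ≤ ‖S h‖ ^ 2 + ‖(h : H)‖ ^ 2)
    (hc : ∀ h k : S.domain,
      ⟪T (Submodule.inclusion ha₂ h), (k : H)⟫ =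
        ⟪(h : H), T (Submodule.inclusion ha₂ k)⟫) :
    (S.sumRestrict T ha₂).IsEssentiallySelfAdjoint := by
  have hD := ha₁.1
  have hS := (LinearPMap.isEssentiallySelfAdjoint_iff hD).1 ha₁
  have hS_symm : ∀ x y : S.domain, ⟪S x, (y : H)⟫ = ⟪(x : H), S y⟫ := fun x y ↦
    sub_eq_zero.1 <| (Submodule.mem_adjoint_iff _ _).1
      (hS ▸ S.graph.le_topologicalClosure (S.mem_graph y)) _ _ (S.mem_graph x)
  refine (LinearPMap.isEssentiallySelfAdjoint_iff (A := S.sumRestrict T ha₂) hD).2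
    (LinearPMap.topologicalClosure_graph_eq_adjoint ?_ ?_)
  · rintro ⟨c, d⟩ hcd
    rw [Submodule.mem_adjoint_iff]
    intro a b hab
    obtain ⟨y, rfl, rfl⟩ := LinearPMap.mem_graph_iff _ |>.1 hcd
    obtain ⟨x, rfl, rfl⟩ := LinearPMap.mem_graph_iff _ |>.1 hab
    change ⟪S x + T (Submodule.inclusion ha₂ x), (y : H)⟫ -
      ⟪(x : H), S y + T (Submodule.inclusion ha₂ y)⟫ = 0
    rw [inner_add_left, inner_add_right, hS_symm x y, hc x y, sub_self]
  · exact LinearMap.denseRange_deficiencyMap_add hD hS_symm hc hb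
      (LinearPMap.denseRange_deficiencyMap hS)
end
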